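/- Let n ∈ ℕ, s ∈ (1,∞)\ℕ, let A be a Young function, and let k ∈ {0,…,[s]−1}. Assume that there are an admissible function φ and a constant c > 0 such that |u|_{𝓛^{k,φ}(ℝⁿ)} ≤ c |∇^{[s]}u|_{{s},A,ℝⁿ} for every u ∈ V^{s,A}_{d,k+1}(ℝⁿ). Then s ∈ (1, n+k+1) and ∫_0 (t/A(t))^{(s−(k+1))/(n−(s−(k+1)))} dt < ∞ (i.e., the integral converges near 0). -/

import Mathlib

open MeasureTheory Metric Set Filter
open scoped ENNReal Topology

noncomputable section

/-- Euclidean space `ℝⁿ`. -/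
abbrev Euc (n : ℕ) := EuclideanSpace ℝ (Fin n)

/-- A Young function: convex, left-continuous, vanishing at `0`,
non-constant on `(0,∞)`, with values in `[0,∞]`. -/
def IsYoung (A : ℝ → ℝ≥0∞) : Prop :=
  A 0 = 0 ∧
  (∀ x y t : ℝ, 0 ≤ x → 0 ≤ y → 0 ≤ t → t ≤ 1 →
      A (t * x + (1 - t) * y) ≤ ENNReal.ofReal t * A x + ENNReal.ofReal (1 - t) * A y) ∧
  (∀ t : ℝ, 0 < t → ContinuousWithinAt A (Set.Iic t) t) ∧
  (∃ t₁ t₂ : ℝ, 0 < t₁ ∧ 0 < t₂ ∧ A t₁ ≠ A t₂)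

/-- The right-continuous generalized inverse of a monotone function `A : [0,∞) → [0,∞]`. -/
def rcInv (A : ℝ → ℝ≥0∞) (v : ℝ≥0∞) : ℝ :=
  sInf {τ : ℝ | 0 ≤ τ ∧ v < A τ}

/-- The Young conjugate `Ã(t) = sup {τ t - A(τ) : τ ≥ 0}`. -/
def youngConj (A : ℝ → ℝ≥0∞) (t : ℝ) : ℝ≥0∞ :=
  ⨆ (τ : ℝ) (_ : 0 ≤ τ), ENNReal.ofReal (τ * t) - A τ

/-- The functional `J_{σ,A}(v)` for a vector-valued `v`, with the Euclidean norm. -/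
def Jfun (n : ℕ) (σ : ℝ) (A : ℝ → ℝ≥0∞) {ι : Type} [Fintype ι]
    (v : Euc n → ι → ℝ) : ℝ≥0∞ :=
  ∫⁻ x : Euc n, ∫⁻ y : Euc n,
    A (Real.sqrt (∑ i, (v x i - v y i) ^ 2) / ‖x - y‖ ^ σ) /
      ENNReal.ofReal (‖x - y‖ ^ (n : ℝ))

/-- The fractional Orlicz–Sobolev seminorm `|v|_{σ,A,ℝⁿ}` (vector-valued version). -/
def fracSem (n : ℕ) (σ : ℝ) (A : ℝ → ℝ≥0∞) {ι : Type} [Fintype ι]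
    (v : Euc n → ι → ℝ) : ℝ≥0∞ :=
  sInf (ENNReal.ofReal '' {lam : ℝ | 0 < lam ∧ Jfun n σ A (fun x i => v x i / lam) ≤ 1})

/-- The fractional Orlicz–Sobolev seminorm `|u|_{σ,A,ℝⁿ}` of a scalar function. -/
def fracSemS (n : ℕ) (σ : ℝ) (A : ℝ → ℝ≥0∞) (u : Euc n → ℝ) : ℝ≥0∞ :=
  fracSem n σ A (fun x (_ : Fin 1) => u x)

/-- The normalized mean oscillation `φ(|B|^{1/n})⁻¹ ⨍_B |u - u_B|` over the ball `B = B(x,r)`. -/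
def oscQuot (n : ℕ) (φ : ℝ → ℝ) (u : Euc n → ℝ) (x : Euc n) (r : ℝ) : ℝ :=
  (φ ((volume (ball x r)).toReal ^ ((n : ℝ)⁻¹)))⁻¹ *
    ⨍ y in ball x r, |u y - ⨍ z in ball x r, u z|

/-- The Campanato seminorm `|u|_{𝓛^φ(ℝⁿ)}`. -/
def campSem (n : ℕ) (φ : ℝ → ℝ) (u : Euc n → ℝ) : ℝ≥0∞ :=
  ⨆ (x : Euc n) (r : ℝ) (_ : 0 < r), ENNReal.ofReal (oscQuot n φ u x r)

/-- The Campanato quantity restricted to balls of measure at most `r`. -/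
def campSemSmall (n : ℕ) (φ : ℝ → ℝ) (u : Euc n → ℝ) (r : ℝ) : ℝ≥0∞ :=
  ⨆ (x : Euc n) (ρ : ℝ) (_ : 0 < ρ) (_ : volume (ball x ρ) ≤ ENNReal.ofReal r),
    ENNReal.ofReal (oscQuot n φ u x ρ)

/-- `φ : (0,∞) → (0,∞)` is admissible: positive and bounded below away from zero on `[a,∞)`. -/
def Admissible (φ : ℝ → ℝ) : Prop :=
  (∀ r : ℝ, 0 < r → 0 < φ r) ∧
  ∀ a : ℝ, 0 < a → ∃ ε : ℝ, 0 < ε ∧ ∀ r : ℝ, a ≤ r → ε ≤ φ r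

/-- `φ_{s,A}(r) = r^s A⁻¹(r^{-n})`. -/
def phiSA (n : ℕ) (s : ℝ) (A : ℝ → ℝ≥0∞) (r : ℝ) : ℝ :=
  r ^ s * rcInv A (ENNReal.ofReal (r ^ (-(n : ℝ))))

/-- `u` is `m`-times weakly differentiable, with iterated weak partial
derivatives recorded by `D`. -/
def HasWeakDerivs (n m : ℕ) (u : Euc n → ℝ)
    (D : (h : ℕ) → Euc n → (Fin h → Fin n) → ℝ) : Prop :=
  (∀ x d, D 0 x d = u x) ∧
  ∀ h : ℕ, h ≤ m → ∀ dirs : Fin h → Fin n,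
    LocallyIntegrable (fun x => D h x dirs) volume ∧
    ∀ φ : Euc n → ℝ, ContDiff ℝ (⊤ : ℕ∞) φ → HasCompactSupport φ →
      ∫ x : Euc n, u x *
          iteratedFDeriv ℝ h φ x (fun i => EuclideanSpace.single (dirs i) (1 : ℝ)) =
        (-1 : ℝ) ^ h * ∫ x : Euc n, D h x dirs * φ x

/-- The Euclidean length `|∇^h u|(x)` of the `h`-th order weak gradient. -/
def gradLen (n : ℕ) (D : (h : ℕ) → Euc n → (Fin h → Fin n) → ℝ) (h : ℕ) (x : Euc n) : ℝ :=
  Real.sqrt (∑ d : Fin h → Fin n, (D h x d) ^ 2)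

/-- The derivatives of orders `k, …, m` decay near infinity:
`|{|∇^h u| > t}| < ∞` for every `t > 0`. -/
def DecayFrom (n k m : ℕ) (D : (h : ℕ) → Euc n → (Fin h → Fin n) → ℝ) : Prop :=
  ∀ h : ℕ, k ≤ h → h ≤ m → ∀ t : ℝ, 0 < t →
    volume {x : Euc n | t < gradLen n D h x} < ⊤

/-- The Young function `F_k(t) = t^{n/(n-s+k+1)} ∫_0^t Ã(τ) τ^{-1-n/(n-s+k+1)} dτ`. -/
def Fk (n : ℕ) (s : ℝ) (k : ℕ) (A : ℝ → ℝ≥0∞) (t : ℝ) : ℝ≥0∞ :=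
  ENNReal.ofReal (t ^ ((n : ℝ) / ((n : ℝ) - s + (k : ℝ) + 1))) *
    ∫⁻ τ in Set.Ioc (0 : ℝ) t,
      youngConj A τ * ENNReal.ofReal (τ ^ (-1 - (n : ℝ) / ((n : ℝ) - s + (k : ℝ) + 1)))

/-- `ψ^k_{s,A}(r) = 1 / (r^{n-s+k} F_k⁻¹(r^{-n}))`. -/
def psiK (n : ℕ) (s : ℝ) (k : ℕ) (A : ℝ → ℝ≥0∞) (r : ℝ) : ℝ :=
  (r ^ ((n : ℝ) - s + (k : ℝ)) * rcInv (Fk n s k A) (ENNReal.ofReal (r ^ (-(n : ℝ)))))⁻¹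

/-- `ψ^{[s]}_{s,A}(r) = r^{{s}} A⁻¹(r^{-n})`. -/
def psiTop (n : ℕ) (s : ℝ) (A : ℝ → ℝ≥0∞) (r : ℝ) : ℝ :=
  r ^ (s - (⌊s⌋₊ : ℝ)) * rcInv A (ENNReal.ofReal (r ^ (-(n : ℝ))))

/-- Convergence near zero of `∫_0 (t/A(t))^{(s-(k+1))/(n-(s-(k+1)))} dt`. -/
def IntCondK (n : ℕ) (s : ℝ) (k : ℕ) (A : ℝ → ℝ≥0∞) : Prop :=
  ∃ ε : ℝ, 0 < ε ∧
    ∫⁻ t in Set.Ioc (0 : ℝ) ε,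
      (ENNReal.ofReal t / A t) ^ ((s - (k : ℝ) - 1) / ((n : ℝ) - (s - (k : ℝ) - 1))) < ⊤

/-- `P` is the projection polynomial `P^k_B[u]`: it has degree at most `k` and its
derivatives up to order `k` match, in the mean over `B`, the weak derivatives `D` of `u`. -/
def IsCampPoly (n k : ℕ) (D : (h : ℕ) → Euc n → (Fin h → Fin n) → ℝ)
    (B : Set (Euc n)) (P : MvPolynomial (Fin n) ℝ) : Prop :=
  P.totalDegree ≤ k ∧
  ∀ h : ℕ, h ≤ k → ∀ dirs : Fin h → Fin n,
    ∫ x in B, D h x dirs =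
      ∫ x in B,
        iteratedFDeriv ℝ h (fun y : Euc n => MvPolynomial.eval (fun i => y i) P) x
          (fun i => EuclideanSpace.single (dirs i) (1 : ℝ))

/-- The normalized oscillation of order `k` over the ball `B(x,r)`. -/
def oscQuotK (n k : ℕ) (φ : ℝ → ℝ) (u : Euc n → ℝ)
    (D : (h : ℕ) → Euc n → (Fin h → Fin n) → ℝ) (x : Euc n) (r : ℝ) : ℝ≥0∞ :=
  ⨅ (P : MvPolynomial (Fin n) ℝ) (_ : IsCampPoly n k D (ball x r) P),
    ENNReal.ofReal
      ((φ ((volume (ball x r)).toReal ^ ((n : ℝ)⁻¹)) *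
          (volume (ball x r)).toReal ^ ((k : ℝ) / (n : ℝ)))⁻¹ *
        ⨍ y in ball x r, |u y - MvPolynomial.eval (fun i => y i) P|)

/-- The `k`-th order Campanato seminorm `|u|_{𝓛^{k,φ}(ℝⁿ)}`. -/
def campSemK (n k : ℕ) (φ : ℝ → ℝ) (u : Euc n → ℝ)
    (D : (h : ℕ) → Euc n → (Fin h → Fin n) → ℝ) : ℝ≥0∞ :=
  ⨆ (x : Euc n) (r : ℝ) (_ : 0 < r), oscQuotK n k φ u D x r

/-- The `k`-th order Campanato quantity restricted to balls of measure at most `r`. -/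
def campSemKSmall (n k : ℕ) (φ : ℝ → ℝ) (u : Euc n → ℝ)
    (D : (h : ℕ) → Euc n → (Fin h → Fin n) → ℝ) (r : ℝ) : ℝ≥0∞ :=
  ⨆ (x : Euc n) (ρ : ℝ) (_ : 0 < ρ) (_ : volume (ball x ρ) ≤ ENNReal.ofReal r),
    oscQuotK n k φ u D x ρ

/-- The Luxemburg norm `‖f‖_{L^A(μ)}`. -/
def luxNorm {α : Type*} [MeasurableSpace α] (A : ℝ → ℝ≥0∞) (μ : Measure α)
    (f : α → ℝ) : ℝ≥0∞ :=
  sInf (ENNReal.ofReal '' {lam : ℝ | 0 < lam ∧ ∫⁻ x, A (|f x| / lam) ∂μ ≤ 1})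

/-- Iterated integral `∫_r^∞ ∫_{r_1}^∞ ⋯ g`. -/
def iterInt : ℕ → (ℝ → ℝ) → (ℝ → ℝ)
  | 0, g => g
  | j + 1, g => fun r => ∫ t in Set.Ioi r, iterInt j g t

end

namespace IsYoung

variable {A : ℝ → ℝ≥0∞}

theorem map_mul_le (hA : IsYoung A) {θ t : ℝ} (hθ0 : 0 ≤ θ) (hθ1 : θ ≤ 1) (ht : 0 ≤ t) :
    A (θ * t) ≤ ENNReal.ofReal θ * A t := by
  simpa [hA.1] using hA.2.1 t 0 θ ht le_rfl hθ0 hθ1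

theorem mono (hA : IsYoung A) {x y : ℝ} (hx : 0 ≤ x) (hxy : x ≤ y) : A x ≤ A y := by
  rcases hx.eq_or_lt with rfl | hx'
  · simp [hA.1]
  have hy : 0 < y := hx'.trans_le hxy
  have h1 : x / y ≤ 1 := (div_le_one hy).2 hxy
  calc A x = A (x / y * y) := by rw [div_mul_cancel₀ _ hy.ne']
    _ ≤ ENNReal.ofReal (x / y) * A y := hA.map_mul_le (by positivity) h1 hy.le
    _ ≤ 1 * A y := by gcongr; simpa using h1
    _ = A y := one_mul _

/-- Jensen's inequality for finite sums with weights of total mass at most one. -/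
theorem map_sum_le (hA : IsYoung A) {ι : Type*} (S : Finset ι) (q b : ι → ℝ)
    (hq : ∀ i ∈ S, 0 ≤ q i) (hb : ∀ i ∈ S, 0 ≤ b i) (hS : ∑ i ∈ S, q i ≤ 1) :
    A (∑ i ∈ S, q i * b i) ≤ ∑ i ∈ S, ENNReal.ofReal (q i) * A (b i) := by
  classical
  induction S using Finset.induction_on generalizing q with
  | empty => simp [hA.1]
  | insert i S hi ih =>
    rw [Finset.sum_insert hi] at hS ⊢
    rw [Finset.sum_insert hi]
    have hqi : 0 ≤ q i := hq i (Finset.mem_insert_self i S)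
    have hbi : 0 ≤ b i := hb i (Finset.mem_insert_self i S)
    have hqS : ∀ j ∈ S, 0 ≤ q j := fun j hj => hq j (Finset.mem_insert_of_mem hj)
    have hbS : ∀ j ∈ S, 0 ≤ b j := fun j hj => hb j (Finset.mem_insert_of_mem hj)
    have hsum : 0 ≤ ∑ j ∈ S, q j := Finset.sum_nonneg hqS
    rcases (show q i ≤ 1 by linarith).eq_or_lt with h1 | h1
    · have hz : ∀ j ∈ S, q j = 0 :=
        (Finset.sum_eq_zero_iff_of_nonneg hqS).1 (by linarith)
      rw [Finset.sum_congr rfl fun j hj => show q j * b j = 0 by rw [hz j hj, zero_mul]]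
      simp [h1]
    · have hp : 0 < 1 - q i := by linarith
      have key : ∑ j ∈ S, q j * b j = (1 - q i) * ∑ j ∈ S, q j / (1 - q i) * b j := by
        rw [Finset.mul_sum]
        exact Finset.sum_congr rfl fun j _ => by field_simp
      have hq' : ∀ j ∈ S, 0 ≤ q j / (1 - q i) := fun j hj => div_nonneg (hqS j hj) hp.le
      calc A (q i * b i + ∑ j ∈ S, q j * b j)
          = A (q i * b i + (1 - q i) * ∑ j ∈ S, q j / (1 - q i) * b j) := by rw [key]
        _ ≤ ENNReal.ofReal (q i) * A (b i) +
            ENNReal.ofReal (1 - q i) * A (∑ j ∈ S, q j / (1 - q i) * b j) :=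
          hA.2.1 _ _ _ hbi
            (Finset.sum_nonneg fun j hj => mul_nonneg (hq' j hj) (hbS j hj)) hqi h1.le
        _ ≤ ENNReal.ofReal (q i) * A (b i) + ENNReal.ofReal (1 - q i) *
            ∑ j ∈ S, ENNReal.ofReal (q j / (1 - q i)) * A (b j) := by
          gcongr
          refine ih _ hq' hbS ?_
          rw [← Finset.sum_div, div_le_one hp]
          linarith
        _ = _ := by
          congr 1
          rw [Finset.mul_sum]
          refine Finset.sum_congr rfl fun j _ => ?_
          rw [← mul_assoc, ← ENNReal.ofReal_mul hp.le, mul_div_cancel₀ _ hp.ne']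

theorem exists_pos_ne_top (hA : IsYoung A) : ∃ t, 0 < t ∧ A t ≠ ⊤ := by
  obtain ⟨t₁, t₂, h1, h2, h⟩ := hA.2.2.2
  by_cases h' : A t₁ = ⊤
  · exact ⟨t₂, h2, fun h'' => h (h'.trans h''.symm)⟩
  · exact ⟨t₁, h1, h'⟩

/-- The quotient `t / A t` is non-increasing. -/
theorem div_antitone (hA : IsYoung A) {x y : ℝ} (hx : 0 < x) (hxy : x ≤ y) :
    ENNReal.ofReal y / A y ≤ ENNReal.ofReal x / A x := by
  have hy : 0 < y := hx.trans_le hxy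
  have h := hA.map_mul_le (θ := x / y) (by positivity) ((div_le_one hy).2 hxy) hy.le
  rw [div_mul_cancel₀ _ hy.ne', ENNReal.ofReal_div_of_pos hy] at h
  have hy0 : ENNReal.ofReal y ≠ 0 := by simpa using hy
  calc ENNReal.ofReal y / A y
      = ENNReal.ofReal x / (ENNReal.ofReal x / ENNReal.ofReal y * A y) := by
        have hx0 : ENNReal.ofReal x ≠ 0 := by simpa using hx
        rw [div_eq_mul_inv, div_eq_mul_inv, ENNReal.mul_inv, ENNReal.inv_div, ← mul_assoc,
          ENNReal.mul_div_cancel hx0 ENNReal.ofReal_ne_top]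
        all_goals simp [hx.not_ge, hy.not_ge, ENNReal.div_eq_top]
    _ ≤ ENNReal.ofReal x / A x := by gcongr

end IsYoung

/-- The discrete inequality behind the embedding: along dyadic scales, a unit bound on
`∑ 2 ^ (j n) A (b j)` controls `∑ 2 ^ (j α) b j`. -/
def DyadicBound (n : ℕ) (α : ℝ) (A : ℝ → ℝ≥0∞) (M : ℝ) : Prop :=
  ∀ (N : ℕ) (b : ℕ → ℝ), (∀ j, 0 ≤ b j) →
    ∑ j ∈ Finset.range N, ENNReal.ofReal (((2 : ℝ) ^ j) ^ n) * A (b j) ≤ 1 →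
    ∑ j ∈ Finset.range N, ((2 : ℝ) ^ j) ^ α * b j ≤ M

theorem DyadicBound.lt_dim {n : ℕ} {α M : ℝ} {A : ℝ → ℝ≥0∞} (hA : IsYoung A)
    (hαn : α ≠ n) (h : DyadicBound n α A M) : α < n := by
  by_contra! hlt
  have hpos : 0 < α - n := sub_pos.2 (lt_of_le_of_ne hlt hαn.symm)
  obtain ⟨t, ht, htop⟩ := hA.exists_pos_ne_top
  set a := (A t).toReal with ha
  have ha0 : 0 ≤ a := ENNReal.toReal_nonneg
  have hAt : A t = ENNReal.ofReal a := (ENNReal.ofReal_toReal htop).symm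
  have bound : ∀ j : ℕ, ((2 : ℝ) ^ (α - n)) ^ j * (t / (a + 1)) ≤ M := by
    intro j
    have h2 : (1 : ℝ) ≤ ((2 : ℝ) ^ j) ^ n := one_le_pow₀ (one_le_pow₀ one_le_two)
    set θ : ℝ := (((2 : ℝ) ^ j) ^ n)⁻¹ * (a + 1)⁻¹ with hθ
    have hθ0 : 0 ≤ θ := by positivity
    have hθ1 : θ ≤ 1 := mul_le_one₀ (inv_le_one_of_one_le₀ h2) (by positivity)
      (inv_le_one_of_one_le₀ (by linarith))
    have := h (j + 1) (fun i => if i = j then θ * t else 0)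
      (fun i => by split_ifs <;> positivity) ?_
    · rw [Finset.sum_range_succ, Finset.sum_eq_zero, zero_add, if_pos rfl] at this
      · refine le_of_eq_of_le ?_ this
        rw [← Real.rpow_natCast (((2 : ℝ) ^ (α - n))), ← Real.rpow_mul zero_le_two, mul_comm,
          mul_comm (α - n), Real.rpow_mul zero_le_two, Real.rpow_natCast,
          Real.rpow_sub (by positivity), Real.rpow_natCast, hθ]
        field_simp
      · intro i hi
        rw [if_neg (Finset.mem_range.1 hi).ne, mul_zero]
    · rw [Finset.sum_range_succ, Finset.sum_eq_zero, zero_add, if_pos rfl]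
      · calc ENNReal.ofReal (((2 : ℝ) ^ j) ^ n) * A (θ * t)
            ≤ ENNReal.ofReal (((2 : ℝ) ^ j) ^ n) * (ENNReal.ofReal θ * ENNReal.ofReal a) := by
              rw [← hAt]; gcongr; exact hA.map_mul_le hθ0 hθ1 ht.le
          _ = ENNReal.ofReal (((2 : ℝ) ^ j) ^ n * (θ * a)) := by
              rw [← ENNReal.ofReal_mul hθ0, ← ENNReal.ofReal_mul (by positivity)]
          _ ≤ 1 := by
              rw [ENNReal.ofReal_le_one]
              have : ((2 : ℝ) ^ j) ^ n * (θ * a) = a / (a + 1) := by rw [hθ]; field_simp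
              rw [this, div_le_one (by positivity)]
              linarith
      · intro i hi
        rw [if_neg (Finset.mem_range.1 hi).ne, hA.1, mul_zero]
  have htend : Tendsto (fun j : ℕ => ((2 : ℝ) ^ (α - n)) ^ j * (t / (a + 1))) atTop atTop :=
    (tendsto_pow_atTop_atTop_of_one_lt (Real.one_lt_rpow one_lt_two hpos)).atTop_mul_const
      (by positivity)
  obtain ⟨j, hj⟩ := (htend.eventually_gt_atTop M).exists
  exact (bound j).not_gt hj

/-- Homogeneous form of `DyadicBound`, obtained by rescaling the sequence. -/
theorem DyadicBound.sum_le {n : ℕ} {α M η : ℝ} {A : ℝ → ℝ≥0∞} (hA : IsYoung A)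
    (h : DyadicBound n α A M) (hη : 0 < η) (hM : M < 1 / η) {b : ℕ → ℝ}
    (hb : ∀ j, 0 ≤ b j) (hbA : ∀ j, ENNReal.ofReal (((2 : ℝ) ^ j) ^ n) * A (b j) ≤
      ENNReal.ofReal (η * (((2 : ℝ) ^ j) ^ α * b j))) (N : ℕ) :
    ∑ j ∈ Finset.range N, ((2 : ℝ) ^ j) ^ α * b j ≤ 1 / η := by
  by_contra! hlt
  set S := ∑ j ∈ Finset.range N, ((2 : ℝ) ^ j) ^ α * b j with hS
  have hS1 : 1 < η * S := by rwa [div_lt_iff₀ hη, mul_comm] at hlt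
  set θ : ℝ := (η * S)⁻¹ with hθ
  have hθ0 : 0 ≤ θ := by positivity
  have hθ1 : θ ≤ 1 := inv_le_one_of_one_le₀ hS1.le
  have hS0 : 0 < S := by by_contra! h0; nlinarith
  have := h N (fun j => θ * b j) (fun j => mul_nonneg hθ0 (hb j)) ?_
  · have h2 : ∑ j ∈ Finset.range N, ((2 : ℝ) ^ j) ^ α * (θ * b j) = θ * S := by
      rw [hS, Finset.mul_sum]
      exact Finset.sum_congr rfl fun j _ => by ring
    have h3 : θ * S = 1 / η := by rw [hθ]; field_simp
    rw [h2, h3] at this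
    linarith
  · calc ∑ j ∈ Finset.range N, ENNReal.ofReal (((2 : ℝ) ^ j) ^ n) * A (θ * b j)
        ≤ ∑ j ∈ Finset.range N, ENNReal.ofReal (θ * (η * (((2 : ℝ) ^ j) ^ α * b j))) := by
          refine Finset.sum_le_sum fun j _ => ?_
          calc _ ≤ ENNReal.ofReal (((2 : ℝ) ^ j) ^ n) * (ENNReal.ofReal θ * A (b j)) := by
                gcongr; exact hA.map_mul_le hθ0 hθ1 (hb j)
            _ = ENNReal.ofReal θ * (ENNReal.ofReal (((2 : ℝ) ^ j) ^ n) * A (b j)) := by ring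
            _ ≤ _ := by rw [ENNReal.ofReal_mul hθ0]; gcongr; exact hbA j
      _ = ENNReal.ofReal (θ * (η * S)) := by
          rw [← ENNReal.ofReal_sum_of_nonneg, hS, Finset.mul_sum, Finset.mul_sum]
          intro j _
          have := hb j
          positivity
      _ ≤ 1 := by
          rw [ENNReal.ofReal_le_one, hθ]
          exact (inv_mul_cancel₀ (by positivity)).le

/-- A dyadic layer-cake bound. -/
theorem lintegral_le_of_dyadic_levels {C : ℝ} (hC : 0 < C) {α K : ℝ} (hα : 0 < α)
    {X : ℝ → ℝ≥0∞} {β : ℕ → ℝ}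
    (hβ : ∀ j, ∀ t ∈ Ioc (0 : ℝ) 1, ENNReal.ofReal (((2 : ℝ) ^ j) ^ α * C) ≤ X t → t ≤ β j)
    (hβ0 : ∀ j, 0 ≤ β j)
    (hK : ∀ N, ∑ j ∈ Finset.range N, ((2 : ℝ) ^ j) ^ α * β j ≤ K) :
    ∫⁻ t in Ioc (0 : ℝ) 1, X t < ⊤ := by
  have hpw : ∀ j : ℕ, ((2 : ℝ) ^ j) ^ α = ((2 : ℝ) ^ α) ^ j := fun j => by
    rw [← Real.rpow_natCast, ← Real.rpow_mul zero_le_two, mul_comm, Real.rpow_mul zero_le_two,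
      Real.rpow_natCast]
  have htend : Tendsto (fun j : ℕ => ((2 : ℝ) ^ j) ^ α) atTop atTop := by
    simp_rw [hpw]
    exact tendsto_pow_atTop_atTop_of_one_lt (Real.one_lt_rpow one_lt_two hα)
  have hterm : ∀ j, ((2 : ℝ) ^ j) ^ α * β j ≤ K := fun j => by
    refine le_trans ?_ (hK (j + 1))
    exact Finset.single_le_sum (f := fun j => ((2 : ℝ) ^ j) ^ α * β j)
      (fun i _ => mul_nonneg (by positivity) (hβ0 i)) (Finset.self_mem_range_succ j)
  have hptw : ∀ t ∈ Ioc (0 : ℝ) 1, X t ≤ ENNReal.ofReal C +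
      ∑' j : ℕ, (Ioc 0 (β j)).indicator
        (fun _ => ENNReal.ofReal ((2 : ℝ) ^ α * (((2 : ℝ) ^ j) ^ α * C))) t := by
    intro t ht
    by_cases hX : X t ≤ ENNReal.ofReal C
    · exact hX.trans le_self_add
    push Not at hX
    have hex : ∃ j : ℕ, X t < ENNReal.ofReal (((2 : ℝ) ^ j) ^ α * C) := by
      obtain ⟨j, hj⟩ := ((htend.atTop_mul_const ht.1).eventually_gt_atTop K).exists
      refine ⟨j, lt_of_not_ge fun hge => ?_⟩
      have h1 := hβ j t ht hge
      have h2 := hterm j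
      have h3 : ((2 : ℝ) ^ j) ^ α * t ≤ ((2 : ℝ) ^ j) ^ α * β j := by gcongr
      linarith
    classical
    have hspec := Nat.find_spec hex
    have hne : Nat.find hex ≠ 0 := by
      intro h0
      rw [h0] at hspec
      simp only [pow_zero, Real.one_rpow, one_mul] at hspec
      exact hX.not_gt hspec
    obtain ⟨J, hJ⟩ := Nat.exists_eq_succ_of_ne_zero hne
    have hJlt : J < Nat.find hex := by omega
    have hge := not_lt.1 (Nat.find_min hex hJlt)
    have htJ := hβ J t ht hge
    rw [hJ] at hspec
    refine le_trans ?_ le_add_self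
    refine le_trans ?_ (ENNReal.le_tsum J)
    rw [indicator_of_mem (show t ∈ Ioc 0 (β J) from ⟨ht.1, htJ⟩)]
    refine hspec.le.trans (le_of_eq ?_)
    congr 1
    rw [hpw, hpw, Nat.succ_eq_add_one, pow_succ]
    ring
  calc ∫⁻ t in Ioc (0 : ℝ) 1, X t
      ≤ ∫⁻ t in Ioc (0 : ℝ) 1, (ENNReal.ofReal C + ∑' j : ℕ, (Ioc 0 (β j)).indicator
        (fun _ => ENNReal.ofReal ((2 : ℝ) ^ α * (((2 : ℝ) ^ j) ^ α * C))) t) :=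
        setLIntegral_mono' measurableSet_Ioc hptw
    _ = (∫⁻ t in Ioc (0 : ℝ) 1, ENNReal.ofReal C) + ∑' j : ℕ, ∫⁻ t in Ioc (0 : ℝ) 1,
        (Ioc 0 (β j)).indicator
        (fun _ => ENNReal.ofReal ((2 : ℝ) ^ α * (((2 : ℝ) ^ j) ^ α * C))) t := by
        rw [lintegral_add_left measurable_const, lintegral_tsum]
        exact fun j => (measurable_const.indicator measurableSet_Ioc).aemeasurable
    _ ≤ ENNReal.ofReal C + ENNReal.ofReal ((2 : ℝ) ^ α * C * K) := by
        gcongr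
        · simp
        · refine ENNReal.tsum_le_of_sum_range_le fun N => ?_
          calc _ ≤ ∑ j ∈ Finset.range N,
                ENNReal.ofReal ((2 : ℝ) ^ α * C * (((2 : ℝ) ^ j) ^ α * β j)) := by
                refine Finset.sum_le_sum fun j _ => ?_
                calc _ ≤ ∫⁻ t : ℝ, (Ioc 0 (β j)).indicator
                      (fun _ => ENNReal.ofReal ((2 : ℝ) ^ α * (((2 : ℝ) ^ j) ^ α * C))) t :=
                      setLIntegral_le_lintegral _ _
                  _ = _ := by
                      rw [lintegral_indicator measurableSet_Ioc, setLIntegral_const,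
                        Real.volume_Ioc, ← ENNReal.ofReal_mul (by positivity)]
                      congr 1
                      ring
            _ = ENNReal.ofReal ((2 : ℝ) ^ α * C *
                ∑ j ∈ Finset.range N, ((2 : ℝ) ^ j) ^ α * β j) := by
                rw [← ENNReal.ofReal_sum_of_nonneg, Finset.mul_sum]
                intro j _
                have := hβ0 j
                positivity
            _ ≤ _ := by gcongr; exact hK N
    _ < ⊤ := by simp

theorem DyadicBound.lintegral_lt_top {n : ℕ} {α M : ℝ} {A : ℝ → ℝ≥0∞} (hA : IsYoung A)
    (hα : 0 < α) (hαn : α < n) (h : DyadicBound n α A M) :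
    ∫⁻ t in Ioc (0 : ℝ) 1, (ENNReal.ofReal t / A t) ^ (α / (n - α)) < ⊤ := by
  have hnα : 0 < n - α := sub_pos.2 hαn
  set η : ℝ := 1 / (|M| + 1) with hη
  have hη0 : 0 < η := by positivity
  have hMη : M < 1 / η := by rw [hη, one_div_one_div]; linarith [le_abs_self M]
  have hγ : 0 < α / (n - α) := by positivity
  set γ := α / (n - α) with hγd
  set C : ℝ := (η⁻¹) ^ γ with hC
  have hC0 : 0 < C := by positivity
  set X : ℝ → ℝ≥0∞ := fun t => (ENNReal.ofReal t / A t) ^ γ with hX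
  set S : ℕ → Set ℝ := fun j => {t | t ∈ Ioc (0 : ℝ) 1 ∧
    ENNReal.ofReal (((2 : ℝ) ^ j) ^ α * C) ≤ X t} with hS
  have hbdd : ∀ j, BddAbove (S j) := fun j => ⟨1, fun t ht => ht.1.2⟩
  have hsup : ∀ j, 0 ≤ sSup (S j) := fun j => Real.sSup_nonneg fun t ht => ht.1.1.le
  have hhalf : ∀ j, ENNReal.ofReal (((2 : ℝ) ^ j) ^ n) * A (sSup (S j) / 2) ≤
      ENNReal.ofReal (η * (((2 : ℝ) ^ j) ^ α * (sSup (S j) / 2))) := by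
    intro j
    rcases (hsup j).eq_or_lt with h0 | h0
    · simp [← h0, hA.1]
    have hne : (S j).Nonempty := by
      by_contra hemp
      rw [not_nonempty_iff_eq_empty] at hemp
      simp [hemp] at h0
    obtain ⟨t, htS, htlt⟩ := exists_lt_of_lt_csSup hne (half_lt_self h0)
    set τ := sSup (S j) / 2 with hτ
    have hτ0 : 0 < τ := by positivity
    have h1 : ENNReal.ofReal (((2 : ℝ) ^ j) ^ α * C) ≤ (ENNReal.ofReal τ / A τ) ^ γ :=
      htS.2.trans (ENNReal.rpow_le_rpow (hA.div_antitone hτ0 htlt.le) hγ.le)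
    have h2 : ((2 : ℝ) ^ j) ^ α * C = (((2 : ℝ) ^ j) ^ ((n : ℝ) - α) * η⁻¹) ^ γ := by
      rw [Real.mul_rpow (by positivity) (by positivity), ← Real.rpow_mul (by positivity), hγd,
        mul_div_cancel₀ _ hnα.ne']
    rw [h2, ← ENNReal.ofReal_rpow_of_pos (by positivity), ENNReal.rpow_le_rpow_iff hγ] at h1
    have h3 := ENNReal.mul_le_of_le_div h1
    calc ENNReal.ofReal (((2 : ℝ) ^ j) ^ n) * A τ
        = ENNReal.ofReal (η * ((2 : ℝ) ^ j) ^ α) *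
          (ENNReal.ofReal (((2 : ℝ) ^ j) ^ ((n : ℝ) - α) * η⁻¹) * A τ) := by
          rw [← mul_assoc, ← ENNReal.ofReal_mul (by positivity)]
          congr 2
          rw [Real.rpow_sub (by positivity), Real.rpow_natCast]
          field_simp
      _ ≤ ENNReal.ofReal (η * ((2 : ℝ) ^ j) ^ α) * ENNReal.ofReal τ := by gcongr
      _ = _ := by rw [← ENNReal.ofReal_mul (by positivity)]; congr 1; ring
  refine lintegral_le_of_dyadic_levels (β := fun j => sSup (S j)) (K := 2 * (1 / η)) hC0 hα
    (fun j t ht hle => le_csSup (hbdd j) ⟨ht, hle⟩) hsup fun N => ?_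
  have := h.sum_le hA hη0 hMη (b := fun j => sSup (S j) / 2)
    (fun j => by have := hsup j; positivity) hhalf N
  calc _ = 2 * ∑ j ∈ Finset.range N, ((2 : ℝ) ^ j) ^ α * (sSup (S j) / 2) := by
        rw [Finset.mul_sum]
        exact Finset.sum_congr rfl fun j _ => by ring
    _ ≤ _ := by linarith

/-- The truncated radial profile `min(r, 1) r^{-σ}`. -/
noncomputable def truncProfile (σ r : ℝ) : ℝ := min r 1 * r ^ (-σ)

theorem truncProfile_nonneg {σ r : ℝ} (hr : 0 ≤ r) : 0 ≤ truncProfile σ r := by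
  unfold truncProfile; positivity

theorem truncProfile_zero (σ : ℝ) : truncProfile σ 0 = 0 := by simp [truncProfile]

theorem truncProfile_of_le_one {σ r : ℝ} (hr : 0 < r) (hr1 : r ≤ 1) :
    truncProfile σ r = r ^ (1 - σ) := by
  rw [truncProfile, min_eq_left hr1, Real.rpow_sub hr, Real.rpow_one, Real.rpow_neg hr.le,
    div_eq_mul_inv]

theorem truncProfile_of_one_le {σ r : ℝ} (hr1 : 1 ≤ r) :
    truncProfile σ r = r ^ (-σ) := by
  rw [truncProfile, min_eq_right hr1, one_mul]

theorem measurable_truncProfile (σ : ℝ) : Measurable (truncProfile σ) := by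
  unfold truncProfile; fun_prop

theorem exists_sum_truncProfile_le {σ : ℝ} (h0 : 0 < σ) (h1 : σ < 1) :
    ∃ C : ℝ, 0 < C ∧ ∀ (N : ℕ) (r : ℝ), 0 ≤ r →
      ∑ j ∈ Finset.range N, truncProfile σ (r / 2 ^ j) ≤ C := by
  have ha : 1 < (2 : ℝ) ^ σ := Real.one_lt_rpow one_lt_two h0
  have hb : (2 : ℝ) ^ (σ - 1) < 1 := Real.rpow_lt_one_of_one_lt_of_neg one_lt_two (by linarith)
  set K : ℝ := ((2 : ℝ) ^ σ - 1)⁻¹ with hK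
  set K' : ℝ := (1 - (2 : ℝ) ^ (σ - 1))⁻¹ with hK'
  have hK0 : 0 < K := inv_pos.2 (by linarith)
  have hK'0 : 0 < K' := inv_pos.2 (by linarith)
  have hKe : K * ((2 : ℝ) ^ σ - 1) = 1 := inv_mul_cancel₀ (by linarith)
  have hK'e : K' * (1 - (2 : ℝ) ^ (σ - 1)) = 1 := inv_mul_cancel₀ (by linarith)
  refine ⟨1 + K + K', by positivity, fun N r hr => ?_⟩
  rcases hr.eq_or_lt with rfl | hr
  · simp only [zero_div, truncProfile_zero, Finset.sum_const_zero]
    positivity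
  set Φ : ℝ → ℝ := fun z => if 1 < z then K * z ^ (-σ) else 1 + K + K' - K' * z ^ (1 - σ) with hΦ
  have step : ∀ z, 0 < z → truncProfile σ z + Φ z ≤ Φ (z / 2) := by
    intro z hz
    have e1 : (z / 2) ^ (-σ) = 2 ^ σ * z ^ (-σ) := by
      rw [Real.div_rpow hz.le zero_le_two, Real.rpow_neg zero_le_two, div_inv_eq_mul, mul_comm]
    have e2 : (z / 2) ^ (1 - σ) = 2 ^ (σ - 1) * z ^ (1 - σ) := by
      rw [Real.div_rpow hz.le zero_le_two, ← neg_sub σ 1, Real.rpow_neg zero_le_two,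
        div_inv_eq_mul, mul_comm]
    simp only [hΦ]
    by_cases hz1 : 1 < z
    · rw [truncProfile_of_one_le hz1.le, if_pos hz1]
      by_cases hz2 : 1 < z / 2
      · rw [if_pos hz2, e1]
        linear_combination (-z ^ (-σ)) * hKe
      · rw [if_neg hz2]
        have h3 : z ^ (-σ) ≤ 1 := Real.rpow_le_one_of_one_le_of_nonpos hz1.le (by linarith)
        have h4 : (z / 2) ^ (1 - σ) ≤ 1 :=
          Real.rpow_le_one (by positivity) (not_lt.1 hz2) (by linarith)
        nlinarith
    · have hz2 : ¬ 1 < z / 2 := by linarith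
      rw [truncProfile_of_le_one hz (not_lt.1 hz1), if_neg hz1, if_neg hz2, e2]
      linear_combination (-z ^ (1 - σ)) * hK'e
  have hnn : ∀ z, 0 < z → 0 ≤ Φ z := by
    intro z hz
    simp only [hΦ]
    split_ifs with h
    · positivity
    · have : z ^ (1 - σ) ≤ 1 := Real.rpow_le_one hz.le (not_lt.1 h) (by linarith)
      nlinarith
  have hle : ∀ z, 0 < z → Φ z ≤ 1 + K + K' := by
    intro z hz
    simp only [hΦ]
    split_ifs with h
    · have : z ^ (-σ) ≤ 1 := Real.rpow_le_one_of_one_le_of_nonpos h.le (by linarith)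
      nlinarith
    · have : 0 ≤ K' * z ^ (1 - σ) := by positivity
      linarith
  have tel : ∀ N : ℕ, ∑ j ∈ Finset.range N, truncProfile σ (r / 2 ^ j) ≤ Φ (r / 2 ^ N) := by
    intro N
    induction N with
    | zero => simpa using hnn r hr
    | succ N ih =>
      rw [Finset.sum_range_succ]
      have := step (r / 2 ^ N) (by positivity)
      rw [div_div, ← pow_succ] at this
      linarith
  exact (tel N).trans (hle _ (by positivity))

theorem lintegral_truncProfile_lt_top {n : ℕ} (hn : 0 < n) {σ : ℝ} (h0 : 0 < σ) (h1 : σ < 1) :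
    ∫⁻ z : Euc n, ENNReal.ofReal (truncProfile σ ‖z‖ / ‖z‖ ^ n) < ⊤ := by
  have : Nonempty (Fin n) := ⟨⟨0, hn⟩⟩
  have hint : Integrable (fun z : Euc n => truncProfile σ ‖z‖ / ‖z‖ ^ n) volume := by
    rw [integrable_fun_norm_addHaar volume (f := fun r => truncProfile σ r / r ^ n)]
    have hdim : Module.finrank ℝ (Euc n) = n := by simp
    rw [hdim, ← Ioc_union_Ioi_eq_Ioi zero_le_one, integrableOn_union]
    have hpow : ∀ y : ℝ, 0 < y → y ^ (n - 1) / y ^ n = y⁻¹ := by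
      intro y hy
      obtain ⟨m, rfl⟩ := Nat.exists_eq_succ_of_ne_zero hn.ne'
      rw [Nat.succ_eq_add_one, Nat.add_sub_cancel, pow_succ]
      field_simp
    constructor
    · have := (intervalIntegral.intervalIntegrable_rpow' (a := 0) (b := 1) (r := -σ)
        (by linarith)).1
      refine this.congr_fun (fun y hy => ?_) measurableSet_Ioc
      simp only [smul_eq_mul]
      rw [← mul_div_assoc, mul_comm, mul_div_assoc, hpow y hy.1,
        truncProfile_of_le_one hy.1 hy.2, Real.rpow_sub hy.1, Real.rpow_one, Real.rpow_neg hy.1.le]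
      field_simp [hy.1.ne']
    · have := integrableOn_Ioi_rpow_of_lt (a := -σ - 1) (c := 1) (by linarith) one_pos
      refine this.congr_fun (fun y hy => ?_) measurableSet_Ioi
      have hy0 : 0 < y := one_pos.trans hy
      simp only [smul_eq_mul]
      rw [← mul_div_assoc, mul_comm, mul_div_assoc, hpow y hy0,
        truncProfile_of_one_le (le_of_lt hy), Real.rpow_sub hy0, Real.rpow_one, div_eq_mul_inv]
  exact hint.lintegral_lt_top

/-- The double kernel `(1_B(x) + 1_B(y)) min(|x-y|, 1) |x-y|^{-σ}` with `B = B(0, R)`. -/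
noncomputable def pairProfile (n : ℕ) (σ R : ℝ) (x y : Euc n) : ℝ :=
  ((closedBall (0 : Euc n) R).indicator 1 x + (closedBall (0 : Euc n) R).indicator 1 y) *
    truncProfile σ ‖x - y‖

theorem indicator_one_nonneg {X : Type*} (S : Set X) (x : X) : (0 : ℝ) ≤ S.indicator 1 x :=
  indicator_nonneg (fun _ _ => zero_le_one) x

theorem indicator_one_le_one {X : Type*} (S : Set X) (x : X) : S.indicator 1 x ≤ (1 : ℝ) :=
  indicator_le_self' (fun _ _ => zero_le_one) x

theorem pairProfile_nonneg {n : ℕ} (σ R : ℝ) (x y : Euc n) : 0 ≤ pairProfile n σ R x y :=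
  mul_nonneg (add_nonneg (indicator_one_nonneg _ _) (indicator_one_nonneg _ _))
    (truncProfile_nonneg (norm_nonneg _))

theorem pairProfile_le {n : ℕ} (σ R : ℝ) (x y : Euc n) :
    pairProfile n σ R x y ≤ 2 * truncProfile σ ‖x - y‖ := by
  refine mul_le_mul_of_nonneg_right ?_ (truncProfile_nonneg (norm_nonneg _))
  linarith [indicator_one_le_one (closedBall (0 : Euc n) R) x,
    indicator_one_le_one (closedBall (0 : Euc n) R) y]

/-- `pairProfile` weighted by `|x-y|^{-n}`. -/
noncomputable def pairKernel (n : ℕ) (σ R : ℝ) (x y : Euc n) : ℝ≥0∞ :=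
  ENNReal.ofReal (pairProfile n σ R x y / ‖x - y‖ ^ n)

theorem measurable_pairKernel (n : ℕ) (σ R : ℝ) :
    Measurable (Function.uncurry (pairKernel n σ R)) := by
  have h1 : Measurable ((closedBall (0 : Euc n) R).indicator (1 : Euc n → ℝ)) :=
    measurable_const.indicator measurableSet_closedBall
  have h2 := measurable_truncProfile σ
  unfold Function.uncurry pairKernel pairProfile
  exact ((((h1.comp measurable_fst).add (h1.comp measurable_snd)).mul
    (h2.comp (by fun_prop))).div (by fun_prop)).ennreal_ofReal

theorem lintegral_pairKernel_lt_top {n : ℕ} (hn : 0 < n) {σ : ℝ} (h0 : 0 < σ) (h1 : σ < 1)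
    (R : ℝ) : ∫⁻ x : Euc n, ∫⁻ y : Euc n, pairKernel n σ R x y < ⊤ := by
  set B := closedBall (0 : Euc n) R
  set κ : Euc n → ℝ≥0∞ := fun z => ENNReal.ofReal (truncProfile σ ‖z‖ / ‖z‖ ^ n) with hκ
  have hκm : Measurable κ :=
    (((measurable_truncProfile σ).comp measurable_norm).div (by fun_prop)).ennreal_ofReal
  have hBm : Measurable (B.indicator (1 : Euc n → ℝ≥0∞)) :=
    measurable_const.indicator measurableSet_closedBall
  have hfin : ∫⁻ x : Euc n, ∫⁻ y : Euc n, B.indicator 1 x * κ (x - y) < ⊤ := by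
    have : ∀ x, ∫⁻ y : Euc n, B.indicator 1 x * κ (x - y) =
        B.indicator 1 x * ∫⁻ z, κ z := fun x => by
      rw [lintegral_const_mul (f := fun y => κ (x - y)) _ (hκm.comp (by fun_prop)),
        lintegral_sub_left_eq_self κ x]
    simp_rw [this]
    rw [lintegral_mul_const _ hBm, lintegral_indicator_one measurableSet_closedBall]
    exact ENNReal.mul_lt_top measure_closedBall_lt_top (lintegral_truncProfile_lt_top hn h0 h1)
  have hsplit : ∀ x y, pairKernel n σ R x y =
      B.indicator 1 x * κ (x - y) + B.indicator 1 y * κ (y - x) := by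
    intro x y
    have hi : ∀ z, ENNReal.ofReal (B.indicator 1 z) = B.indicator 1 z := fun z => by
      by_cases hz : z ∈ B <;> simp [hz]
    rw [hκ]
    simp only
    rw [norm_sub_rev y x, ← add_mul, ← hi, ← hi, ← ENNReal.ofReal_add
      (indicator_one_nonneg _ _) (indicator_one_nonneg _ _), ← ENNReal.ofReal_mul
      (add_nonneg (indicator_one_nonneg _ _) (indicator_one_nonneg _ _)), pairKernel,
      pairProfile, mul_div_assoc]
  have hm : Measurable fun p : Euc n × Euc n => B.indicator 1 p.1 * κ (p.1 - p.2) :=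
    (hBm.comp measurable_fst).mul (hκm.comp (by fun_prop))
  simp_rw [hsplit]
  have : ∀ x : Euc n, ∫⁻ y : Euc n, (B.indicator 1 x * κ (x - y) + B.indicator 1 y * κ (y - x)) =
      (∫⁻ y : Euc n, B.indicator 1 x * κ (x - y)) + ∫⁻ y : Euc n, B.indicator 1 y * κ (y - x) :=
    fun x => lintegral_add_left (hm.comp (measurable_const.prodMk measurable_id)) _
  simp_rw [this]
  rw [lintegral_add_left (Measurable.lintegral_prod_right' hm)]
  refine ENNReal.add_lt_top.2 ⟨hfin, ?_⟩
  rw [lintegral_lintegral_swap]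
  · exact hfin
  · exact (hm.comp measurable_swap).aemeasurable

theorem lintegral_comp_smul_of_pos {n : ℕ} (f : Euc n → ℝ≥0∞) {c : ℝ} (hc : 0 < c) :
    ∫⁻ x, f (c • x) = ENNReal.ofReal ((c ^ n)⁻¹) * ∫⁻ x, f x := by
  have := lintegral_map_equiv f (Homeomorph.smulOfNeZero c hc.ne').toMeasurableEquiv
    (μ := (volume : Measure (Euc n)))
  have h2 : Measure.map (Homeomorph.smulOfNeZero c hc.ne').toMeasurableEquiv
    (volume : Measure (Euc n)) = ENNReal.ofReal ((c ^ n)⁻¹) • volume := by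
    have := Measure.map_addHaar_smul (volume : Measure (Euc n)) hc.ne'
    rw [finrank_euclideanSpace_fin, abs_of_pos (by positivity)] at this
    exact this
  rw [h2, lintegral_smul_measure, smul_eq_mul] at this
  exact this.symm

theorem lintegral_pairKernel_comp_smul {n : ℕ} (σ R : ℝ) {c : ℝ} (hc : 0 < c) :
    ∫⁻ x : Euc n, ∫⁻ y : Euc n, pairKernel n σ R (c • x) (c • y) =
      ENNReal.ofReal ((c ^ n)⁻¹) * (ENNReal.ofReal ((c ^ n)⁻¹) *
        ∫⁻ x : Euc n, ∫⁻ y : Euc n, pairKernel n σ R x y) := by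
  have h1 : ∀ x : Euc n, ∫⁻ y : Euc n, pairKernel n σ R (c • x) (c • y) =
      ENNReal.ofReal ((c ^ n)⁻¹) * ∫⁻ y : Euc n, pairKernel n σ R (c • x) y :=
    fun x => lintegral_comp_smul_of_pos (pairKernel n σ R (c • x)) hc
  simp_rw [h1]
  rw [lintegral_const_mul', lintegral_comp_smul_of_pos
    (fun x => ∫⁻ y : Euc n, pairKernel n σ R x y) hc]
  exact ENNReal.ofReal_ne_top

theorem lintegral_lintegral_const_mul {n : ℕ} (c : ℝ≥0∞) {f : Euc n → Euc n → ℝ≥0∞}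
    (hf : Measurable (Function.uncurry f)) :
    ∫⁻ x, ∫⁻ y, c * f x y = c * ∫⁻ x, ∫⁻ y, f x y := by
  refine Eq.trans ?_ (lintegral_const_mul c (Measurable.lintegral_prod_right' hf))
  refine lintegral_congr fun x => ?_
  exact lintegral_const_mul c (hf.comp (measurable_const.prodMk measurable_id))

theorem lintegral_lintegral_finsetSum {n : ℕ} (S : Finset ℕ) {f : ℕ → Euc n → Euc n → ℝ≥0∞}
    (hf : ∀ j, Measurable (Function.uncurry (f j))) :
    ∫⁻ x, ∫⁻ y, ∑ j ∈ S, f j x y = ∑ j ∈ S, ∫⁻ x, ∫⁻ y, f j x y := by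
  refine Eq.trans ?_ (lintegral_finsetSum S fun j _ => Measurable.lintegral_prod_right' (hf j))
  refine lintegral_congr fun x => ?_
  exact lintegral_finsetSum S fun j _ => (hf j).comp (measurable_const.prodMk measurable_id)

theorem IsYoung.div_le_sum_pairKernel {n : ℕ} {A : ℝ → ℝ≥0∞} (hA : IsYoung A)
    {σ R L C : ℝ} (hL : 0 ≤ L) (hLC : L * (2 * C) ≤ 1)
    (hC : ∀ (N : ℕ) (r : ℝ), 0 ≤ r → ∑ j ∈ Finset.range N, truncProfile σ (r / 2 ^ j) ≤ C)
    (N : ℕ) {b : ℕ → ℝ} (hb : ∀ j, 0 ≤ b j) {q : ℝ} (hq : 0 ≤ q) {x y : Euc n} (hxy : x ≠ y)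
    (hV : q ≤ ∑ j ∈ Finset.range N,
        L * pairProfile n σ R (((2 : ℝ) ^ j)⁻¹ • x) (((2 : ℝ) ^ j)⁻¹ • y) * b j) :
    A q / ENNReal.ofReal (‖x - y‖ ^ (n : ℝ)) ≤
      ∑ j ∈ Finset.range N, A (b j) * (ENNReal.ofReal L * (ENNReal.ofReal ((((2 : ℝ) ^ j)⁻¹) ^ n) *
        pairKernel n σ R (((2 : ℝ) ^ j)⁻¹ • x) (((2 : ℝ) ^ j)⁻¹ • y))) := by
  have hnorm : ∀ j : ℕ,
      ‖((2 : ℝ) ^ j)⁻¹ • x - ((2 : ℝ) ^ j)⁻¹ • y‖ = ‖x - y‖ / 2 ^ j := fun j => by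
    rw [← smul_sub, norm_smul, Real.norm_of_nonneg (by positivity), inv_mul_eq_div]
  have hpos : 0 < ‖x - y‖ := norm_pos_iff.2 (sub_ne_zero.2 hxy)
  have hJ : A q ≤
      ∑ j ∈ Finset.range N, ENNReal.ofReal
        (L * pairProfile n σ R (((2 : ℝ) ^ j)⁻¹ • x) (((2 : ℝ) ^ j)⁻¹ • y)) * A (b j) := by
    refine (hA.mono hq hV).trans (hA.map_sum_le _ _ _
      (fun j _ => mul_nonneg hL (pairProfile_nonneg _ _ _ _)) (fun j _ => hb j) ?_)
    calc _ ≤ ∑ j ∈ Finset.range N, L * (2 * truncProfile σ (‖x - y‖ / 2 ^ j)) := by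
          refine Finset.sum_le_sum fun j _ => ?_
          rw [← hnorm]
          exact mul_le_mul_of_nonneg_left (pairProfile_le _ _ _ _) hL
      _ = L * (2 * ∑ j ∈ Finset.range N, truncProfile σ (‖x - y‖ / 2 ^ j)) := by
          rw [Finset.mul_sum, Finset.mul_sum]
      _ ≤ L * (2 * C) := by gcongr; exact hC N _ hpos.le
      _ ≤ 1 := hLC
  rw [Real.rpow_natCast]
  refine (ENNReal.div_le_div_right hJ _).trans (le_of_eq ?_)
  rw [div_eq_mul_inv, Finset.sum_mul]
  refine Finset.sum_congr rfl fun j _ => ?_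
  rw [← ENNReal.ofReal_inv_of_pos (by positivity), pairKernel, hnorm,
    ← ENNReal.ofReal_mul (by positivity), ← ENNReal.ofReal_mul hL, mul_right_comm,
    ← ENNReal.ofReal_mul (mul_nonneg hL (pairProfile_nonneg _ _ _ _)), mul_comm]
  congr 2
  rw [div_pow, inv_pow]
  field_simp

theorem Measurable.uncurry_comp_smul {n : ℕ} {f : Euc n → Euc n → ℝ≥0∞}
    (hf : Measurable (Function.uncurry f)) (c : ℝ) :
    Measurable (Function.uncurry fun x y => f (c • x) (c • y)) := by
  have h : Measurable fun p : Euc n × Euc n => (c • p.1, c • p.2) :=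
    (measurable_fst.const_smul c).prodMk (measurable_snd.const_smul c)
  exact hf.comp h

theorem Jfun_le_of_pairProfile {n : ℕ} {A : ℝ → ℝ≥0∞} (hA : IsYoung A)
    {σ R L C : ℝ} {ι : Type} [Fintype ι] (V : Euc n → ι → ℝ)
    (hL : 0 ≤ L) (hLC : L * (2 * C) ≤ 1)
    (hC : ∀ (N : ℕ) (r : ℝ), 0 ≤ r → ∑ j ∈ Finset.range N, truncProfile σ (r / 2 ^ j) ≤ C)
    (hLI : ENNReal.ofReal L * ∫⁻ x : Euc n, ∫⁻ y : Euc n, pairKernel n σ R x y ≤ 1)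
    (N : ℕ) {b : ℕ → ℝ} (hb : ∀ j, 0 ≤ b j)
    (hV : ∀ x y, Real.sqrt (∑ i, (V x i - V y i) ^ 2) / ‖x - y‖ ^ σ ≤
      ∑ j ∈ Finset.range N,
        L * pairProfile n σ R (((2 : ℝ) ^ j)⁻¹ • x) (((2 : ℝ) ^ j)⁻¹ • y) * b j) :
    Jfun n σ A V ≤ ∑ j ∈ Finset.range N, ENNReal.ofReal (((2 : ℝ) ^ j) ^ n) * A (b j) := by
  set c : ℕ → ℝ≥0∞ := fun j =>
    A (b j) * ENNReal.ofReal L * ENNReal.ofReal ((((2 : ℝ) ^ j)⁻¹) ^ n) with hc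
  set κ : ℕ → Euc n → Euc n → ℝ≥0∞ := fun j x y =>
    pairKernel n σ R (((2 : ℝ) ^ j)⁻¹ • x) (((2 : ℝ) ^ j)⁻¹ • y) with hκ
  have hm : ∀ j, Measurable (Function.uncurry (κ j)) := fun j =>
    (measurable_pairKernel n σ R).uncurry_comp_smul _
  have hm' : ∀ j, Measurable (Function.uncurry fun x y => c j * κ j x y) := fun j =>
    (hm j).const_mul (c j)
  have hptw : ∀ x y : Euc n,
      A (Real.sqrt (∑ i, (V x i - V y i) ^ 2) / ‖x - y‖ ^ σ) /
        ENNReal.ofReal (‖x - y‖ ^ (n : ℝ)) ≤ ∑ j ∈ Finset.range N, c j * κ j x y := by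
    intro x y
    rcases eq_or_ne x y with rfl | hxy
    · simp [hA.1]
    simpa only [hc, hκ, mul_assoc] using
      hA.div_le_sum_pairKernel hL hLC hC N hb (by positivity) hxy (hV x y)
  refine (lintegral_mono fun x => lintegral_mono fun y => hptw x y).trans ?_
  rw [lintegral_lintegral_finsetSum _ hm']
  refine Finset.sum_le_sum fun j _ => ?_
  rw [lintegral_lintegral_const_mul _ (hm j),
    lintegral_pairKernel_comp_smul σ R (by positivity)]
  set I := ∫⁻ x : Euc n, ∫⁻ y : Euc n, pairKernel n σ R x y
  have h1 : ENNReal.ofReal ((((2 : ℝ) ^ j)⁻¹) ^ n) *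
      ENNReal.ofReal (((((2 : ℝ) ^ j)⁻¹) ^ n)⁻¹) = 1 := by
    rw [← ENNReal.ofReal_mul (by positivity), mul_inv_cancel₀ (by positivity), ENNReal.ofReal_one]
  have h2 : ((((2 : ℝ) ^ j)⁻¹) ^ n)⁻¹ = ((2 : ℝ) ^ j) ^ n := by rw [inv_pow, inv_inv]
  rw [hc]
  simp only
  rw [mul_assoc, ← mul_assoc (ENNReal.ofReal ((((2 : ℝ) ^ j)⁻¹) ^ n)), h1, one_mul, h2]
  calc A (b j) * ENNReal.ofReal L * (ENNReal.ofReal (((2 : ℝ) ^ j) ^ n) * I)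
      = ENNReal.ofReal (((2 : ℝ) ^ j) ^ n) * A (b j) * (ENNReal.ofReal L * I) := by ring
    _ ≤ ENNReal.ofReal (((2 : ℝ) ^ j) ^ n) * A (b j) * 1 := by gcongr
    _ = _ := mul_one _

theorem exists_norm_sub_le_indicator {n : ℕ} {F : Type*} [NormedAddCommGroup F] [NormedSpace ℝ F]
    {G : Euc n → F} (hG : ContDiff ℝ 1 G) (hc : HasCompactSupport G) :
    ∃ M R : ℝ, 0 ≤ M ∧ ∀ x y, ‖G x - G y‖ ≤ M * (((closedBall (0 : Euc n) R).indicator 1 x +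
      (closedBall (0 : Euc n) R).indicator 1 y) * min ‖x - y‖ 1) := by
  obtain ⟨C₁, hC₁⟩ := hG.lipschitzWith_of_hasCompactSupport hc one_ne_zero
  obtain ⟨C₂, hC₂⟩ := hc.exists_bound_of_continuous hG.continuous
  obtain ⟨R, hR⟩ := hc.isCompact.isBounded.subset_closedBall (0 : Euc n)
  have hC₂0 : 0 ≤ C₂ := (norm_nonneg _).trans (hC₂ 0)
  refine ⟨C₁ + 2 * C₂, R, by positivity, fun x y => ?_⟩
  have hz : ∀ x, x ∉ closedBall (0 : Euc n) R → G x = 0 := fun x hx =>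
    image_eq_zero_of_notMem_tsupport fun h => hx (hR h)
  have hmin : ‖G x - G y‖ ≤ (C₁ + 2 * C₂) * min ‖x - y‖ 1 := by
    rcases le_total ‖x - y‖ 1 with h | h
    · rw [min_eq_left h]
      have h1 := hC₁.norm_sub_le x y
      have h2 : 0 ≤ 2 * C₂ * ‖x - y‖ := by positivity
      linarith
    · rw [min_eq_right h]
      have h1 := norm_sub_le (G x) (G y)
      have h2 := hC₂ x
      have h3 := hC₂ y
      have h4 : (0 : ℝ) ≤ C₁ := C₁.2
      linarith
  have hK : 0 ≤ (C₁ + 2 * C₂) * min ‖x - y‖ 1 := by positivity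
  by_cases hx : x ∈ closedBall (0 : Euc n) R
  · have hi := indicator_one_nonneg (closedBall (0 : Euc n) R) y
    rw [indicator_of_mem hx, Pi.one_apply]
    nlinarith
  · by_cases hy : y ∈ closedBall (0 : Euc n) R
    · rw [indicator_of_notMem hx, indicator_of_mem hy, Pi.one_apply, zero_add, one_mul]
      exact hmin
    · simp [hz x hx, hz y hy, hx, hy]

/-- Iterated integration by parts for smooth compactly supported functions. -/
theorem integral_mul_iteratedFDeriv {n : ℕ} {h : ℕ} {u φ : Euc n → ℝ}
    (hu : ContDiff ℝ (⊤ : ℕ∞) u) (huc : HasCompactSupport u)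
    (hφ : ContDiff ℝ (⊤ : ℕ∞) φ) (hφc : HasCompactSupport φ) (v : Fin h → Euc n) :
    ∫ x, u x * iteratedFDeriv ℝ h φ x v =
      (-1 : ℝ) ^ h * ∫ x, iteratedFDeriv ℝ h u x (fun i => v (Fin.rev i)) * φ x := by
  induction h generalizing u with
  | zero => simp
  | succ h ih =>
    set g : Euc n → ℝ := fun y => iteratedFDeriv ℝ h φ y (Fin.tail v) with hg
    have hDφ : ContDiff ℝ (⊤ : ℕ∞) (iteratedFDeriv ℝ h φ) :=
      hφ.iteratedFDeriv_right (by exact_mod_cast le_top)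
    have hgs : ContDiff ℝ (⊤ : ℕ∞) g :=
      (ContinuousMultilinearMap.apply ℝ (fun _ : Fin h => Euc n) ℝ
        (Fin.tail v)).contDiff.comp hDφ
    have hgc : HasCompactSupport g := (hφc.iteratedFDeriv (𝕜 := ℝ) h).comp_left
      (g := fun T : ContinuousMultilinearMap ℝ (fun _ : Fin h => Euc n) ℝ => T (Fin.tail v)) rfl
    set u' : Euc n → ℝ := fun x => fderiv ℝ u x (v 0) with hu'
    have hDu : ContDiff ℝ (⊤ : ℕ∞) (fderiv ℝ u) := hu.fderiv_right (by exact_mod_cast le_top)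
    have hu's : ContDiff ℝ (⊤ : ℕ∞) u' := hDu.clm_apply contDiff_const
    have hu'c : HasCompactSupport u' := huc.fderiv_apply ℝ (v 0)
    have hg's : Continuous fun x => fderiv ℝ g x (v 0) :=
      (hgs.continuous_fderiv (by simp)).clm_apply continuous_const
    have e1 : ∀ x, iteratedFDeriv ℝ (h + 1) φ x v = fderiv ℝ g x (v 0) := fun x =>
      (hDφ.differentiable (by simp) x).iteratedFDeriv_succ_apply_left'
    have e2 : ∀ x, iteratedFDeriv ℝ h u' x (fun i => Fin.tail v (Fin.rev i)) =
        iteratedFDeriv ℝ (h + 1) u x (fun i => v (Fin.rev i)) := by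
      intro x
      rw [iteratedFDeriv_succ_apply_right]
      have := (ContinuousLinearMap.apply ℝ ℝ (v 0)).iteratedFDeriv_comp_left
        (hDu.contDiffAt (x := x)) (i := h) (by exact_mod_cast le_top)
      have h3 : u' = (ContinuousLinearMap.apply ℝ ℝ (v 0)) ∘ fderiv ℝ u := rfl
      rw [h3, this]
      simp only [ContinuousLinearMap.compContinuousMultilinearMap_coe, Function.comp_apply,
        ContinuousLinearMap.apply_apply, Fin.rev_last]
      congr 2
      ext i : 1
      simp [Fin.tail, Fin.init, Fin.rev_castSucc]
    simp_rw [e1]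
    rw [integral_mul_fderiv_eq_neg_fderiv_mul_of_integrable]
    · have := ih hu's hu'c (Fin.tail v)
      simp_rw [e2] at this
      change -∫ x, u' x * g x = _
      rw [hg, this, pow_succ]
      ring
    · exact (hu's.continuous.mul hgs.continuous).integrable_of_hasCompactSupport hu'c.mul_right
    · exact (hu.continuous.mul hg's).integrable_of_hasCompactSupport huc.mul_right
    · exact (hu.continuous.mul hgs.continuous).integrable_of_hasCompactSupport huc.mul_right
    · exact fun x _ => hu.differentiable (by simp) x
    · exact fun x _ => hgs.differentiable (by simp) x

theorem sum_choose_mul_sub_eval {k : ℕ} (a x : ℝ) {Q : Polynomial ℝ} (hQ : Q.natDegree ≤ k) :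
    ∑ i ∈ Finset.range (k + 2), ((-1 : ℝ) ^ (k + 1 - i) * (k + 1).choose i) *
      (a * (x + i) ^ (k + 1) - Q.eval (i : ℝ)) = a * (k + 1).factorial := by
  have h1 := congrFun (Polynomial.fwdDiff_iter_eq_zero_of_degree_lt (Nat.lt_succ_of_le hQ)) 0
  have h2 := congrFun (fwdDiff_iter_eq_factorial (R := ℝ) (n := k + 1)) x
  rw [fwdDiff_iter_eq_sum_shift] at h1 h2
  simp only [zsmul_eq_mul, nsmul_eq_mul, mul_one, zero_add, Pi.zero_apply, Pi.natCast_apply,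
    Nat.succ_eq_add_one] at h1 h2
  push_cast at h1 h2
  rw [← h2, ← sub_zero (a * _), ← h1, Finset.mul_sum, ← Finset.sum_sub_distrib]
  exact Finset.sum_congr rfl fun i _ => by ring

theorem abs_mul_factorial_le_sum {k : ℕ} (a x : ℝ) {Q : Polynomial ℝ} (hQ : Q.natDegree ≤ k) :
    |a| * (k + 1).factorial ≤ ∑ i ∈ Finset.range (k + 2), ((k + 1).choose i : ℝ) *
      |a * (x + i) ^ (k + 1) - Q.eval (i : ℝ)| := by
  rw [← Nat.abs_cast (k + 1).factorial, ← abs_mul, ← sum_choose_mul_sub_eval a x hQ]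
  refine (Finset.abs_sum_le_sum_abs _ _).trans (Finset.sum_le_sum fun i _ => ?_)
  rw [abs_mul, abs_mul, abs_pow, abs_neg, abs_one, one_pow, one_mul, Nat.abs_cast]

theorem setIntegral_ball_add {n : ℕ} (g : Euc n → ℝ) (v : Euc n) (r : ℝ) :
    ∫ x in ball (0 : Euc n) r, g (x + v) = ∫ x in ball v r, g x := by
  rw [← (measurePreserving_add_right volume v).setIntegral_preimage_emb
    (MeasurableEquiv.addRight v).measurableEmbedding g (ball v r)]
  congr 2
  ext x
  simp

theorem continuous_eval_euc {n : ℕ} (P : MvPolynomial (Fin n) ℝ) :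
    Continuous fun y : Euc n => MvPolynomial.eval (fun i => y i) P :=
  P.continuous_eval.comp (by fun_prop : Continuous fun (y : Euc n) i => y i)

/-- A monomial of degree `k + 1` in one variable stays at a definite mean distance from
polynomials of degree at most `k`. -/
theorem mul_le_setIntegral_sub_eval {n k : ℕ} (i₀ : Fin n) (a : ℝ) {u : Euc n → ℝ}
    (hu : ∀ x ∈ ball (0 : Euc n) (k + 3), u x = a * (x i₀) ^ (k + 1))
    {P : MvPolynomial (Fin n) ℝ} (hP : P.totalDegree ≤ k) :
    |a| * (k + 1).factorial * volume.real (ball (0 : Euc n) 1) ≤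
      2 ^ (k + 1) * ∫ y in ball (0 : Euc n) (k + 3),
        |u y - MvPolynomial.eval (fun i => y i) P| := by
  set g : Euc n → ℝ := fun x => |a * (x i₀) ^ (k + 1) - MvPolynomial.eval (fun i => x i) P| with hg
  have hgc : Continuous g := by
    have := continuous_eval_euc P
    fun_prop
  have hgi : ∀ v : Euc n, ∀ r, IntegrableOn g (ball v r) := fun v r =>
    (hgc.continuousOn.integrableOn_compact (isCompact_closedBall v r)).mono_set
      ball_subset_closedBall
  have e1 : ∫ y in ball (0 : Euc n) (k + 3), |u y - MvPolynomial.eval (fun i => y i) P| =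
      ∫ y in ball (0 : Euc n) (k + 3), g y :=
    setIntegral_congr_fun measurableSet_ball fun x hx => by simp only [hg, hu x hx]
  set e : Euc n := EuclideanSpace.single i₀ 1 with he
  have hpt : ∀ x : Euc n, |a| * (k + 1).factorial ≤
      ∑ i ∈ Finset.range (k + 2), ((k + 1).choose i : ℝ) * g (x + (i : ℝ) • e) := by
    intro x
    set Q : Polynomial ℝ := MvPolynomial.aeval
      (fun j => Polynomial.C (x j) + Polynomial.C (e j) * Polynomial.X) P with hQ
    have hQd : Q.natDegree ≤ k := by
      have := MvPolynomial.aeval_natDegree_le (n := 1) P hP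
        (fun j => Polynomial.C (x j) + Polynomial.C (e j) * Polynomial.X) (fun j => by compute_degree)
      rwa [mul_one] at this
    have hQe : ∀ t : ℝ, Q.eval t = MvPolynomial.eval (fun j => (x + t • e) j) P := fun t => by
      rw [hQ, ← Polynomial.coe_evalRingHom, MvPolynomial.aeval_def, MvPolynomial.hom_eval₂]
      rw [MvPolynomial.eval, MvPolynomial.coe_eval₂Hom]
      congr 1
      · ext; simp
      · ext j; simp only [PiLp.add_apply, PiLp.smul_apply, smul_eq_mul,
          Polynomial.coe_evalRingHom, Polynomial.eval_add, Polynomial.eval_C, Polynomial.eval_mul,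
          Polynomial.eval_X, mul_comm]
    refine (abs_mul_factorial_le_sum a (x i₀) hQd).trans (le_of_eq ?_)
    refine Finset.sum_congr rfl fun i _ => ?_
    rw [hQe, hg]
    simp [he]
  have hshift : ∀ i ∈ Finset.range (k + 2), ∫ x in ball (0 : Euc n) 1, g (x + (i : ℝ) • e) ≤
      ∫ x in ball (0 : Euc n) (k + 3), g x := by
    intro i hi
    rw [setIntegral_ball_add]
    refine setIntegral_mono_set (hgi _ _) (ae_of_all _ fun x => abs_nonneg _)
      (LE.le.eventuallyLE (ball_subset_ball' ?_))
    have : ((i : ℕ) : ℝ) ≤ k + 1 := by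
      exact_mod_cast Nat.lt_succ_iff.1 (Finset.mem_range.1 hi)
    rw [dist_zero_right, norm_smul, he, PiLp.norm_single]
    simp
    linarith
  have hint : ∀ i ∈ Finset.range (k + 2), IntegrableOn
      (fun x => ((k + 1).choose i : ℝ) * g (x + (i : ℝ) • e)) (ball (0 : Euc n) 1) := fun i _ =>
    ((by fun_prop : Continuous fun x => ((k + 1).choose i : ℝ) * g (x + (i : ℝ) • e)
      ).continuousOn.integrableOn_compact (isCompact_closedBall 0 1)).mono_set
      ball_subset_closedBall
  rw [e1]
  calc |a| * (k + 1).factorial * volume.real (ball (0 : Euc n) 1)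
      = ∫ x in ball (0 : Euc n) 1, |a| * (k + 1).factorial := by
        rw [setIntegral_const, smul_eq_mul, mul_comm]
    _ ≤ ∫ x in ball (0 : Euc n) 1,
          ∑ i ∈ Finset.range (k + 2), ((k + 1).choose i : ℝ) * g (x + (i : ℝ) • e) :=
        setIntegral_mono (integrableOn_const measure_ball_lt_top.ne) (integrable_finsetSum _ hint)
          hpt
    _ = ∑ i ∈ Finset.range (k + 2), ((k + 1).choose i : ℝ) *
          ∫ x in ball (0 : Euc n) 1, g (x + (i : ℝ) • e) := by
        rw [integral_finsetSum _ hint]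
        simp_rw [integral_const_mul]
    _ ≤ ∑ i ∈ Finset.range (k + 2), ((k + 1).choose i : ℝ) *
          ∫ x in ball (0 : Euc n) (k + 3), g x := by
        refine Finset.sum_le_sum fun i hi => ?_
        exact mul_le_mul_of_nonneg_left (hshift i hi) (by positivity)
    _ = 2 ^ (k + 1) * ∫ x in ball (0 : Euc n) (k + 3), g x := by
        rw [← Finset.sum_mul]
        congr 1
        exact_mod_cast Nat.sum_range_choose (k + 1)

theorem exists_mul_le_oscQuotK {n : ℕ} (i₀ : Fin n) (k : ℕ) {φ : ℝ → ℝ} (hφ : Admissible φ) :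
    ∃ κ : ℝ, 0 < κ ∧ ∀ (u : Euc n → ℝ) (D : (h : ℕ) → Euc n → (Fin h → Fin n) → ℝ) (a : ℝ),
      (∀ x ∈ ball (0 : Euc n) (k + 3), u x = a * (x i₀) ^ (k + 1)) →
      ENNReal.ofReal (κ * |a|) ≤ oscQuotK n k φ u D 0 (k + 3) := by
  have hpos : ∀ r : ℝ, 0 < r → 0 < (volume (ball (0 : Euc n) r)).toReal := fun r hr =>
    ENNReal.toReal_pos (measure_ball_pos _ _ hr).ne' measure_ball_lt_top.ne
  set V := (volume (ball (0 : Euc n) (k + 3))).toReal with hV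
  have hV0 : 0 < V := hpos _ (by positivity)
  have hv := hpos 1 one_pos
  have hφV := hφ.1 (V ^ ((n : ℝ)⁻¹)) (by positivity)
  set q := (φ (V ^ ((n : ℝ)⁻¹)) * V ^ ((k : ℝ) / n))⁻¹ with hq
  have hq0 : 0 < q := by positivity
  refine ⟨q * (V⁻¹ * ((k + 1).factorial * volume.real (ball (0 : Euc n) 1) / 2 ^ (k + 1))),
    by have := hv; unfold Measure.real; positivity, fun u D a hu => ?_⟩
  refine le_iInf₂ fun P hP => ENNReal.ofReal_le_ofReal ?_
  have := mul_le_setIntegral_sub_eval i₀ a hu hP.1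
  rw [setAverage_eq, smul_eq_mul, mul_assoc, mul_assoc]
  refine mul_le_mul_of_nonneg_left (mul_le_mul_of_nonneg_left ?_ (by positivity)) hq0.le
  rw [div_mul_eq_mul_div, div_le_iff₀' (by positivity)]
  linarith

/-- The array of classical partial derivatives of order `h`, the directions being applied in
reverse order. -/
noncomputable def partials (n : ℕ) (u : Euc n → ℝ) (h : ℕ) (x : Euc n) (d : Fin h → Fin n) : ℝ :=
  iteratedFDeriv ℝ h u x fun i => EuclideanSpace.single (d (Fin.rev i)) (1 : ℝ)

theorem continuous_partials {n : ℕ} {u : Euc n → ℝ} (hu : ContDiff ℝ (⊤ : ℕ∞) u) (h : ℕ)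
    (d : Fin h → Fin n) : Continuous fun x => partials n u h x d :=
  (ContinuousMultilinearMap.apply ℝ (fun _ : Fin h => Euc n) ℝ _).continuous.comp
    (hu.continuous_iteratedFDeriv (by exact_mod_cast le_top))

theorem hasWeakDerivs_partials {n : ℕ} {u : Euc n → ℝ} (hu : ContDiff ℝ (⊤ : ℕ∞) u)
    (huc : HasCompactSupport u) (m : ℕ) : HasWeakDerivs n m u (partials n u) :=
  ⟨fun x d => by simp [partials], fun h _ d =>
    ⟨(continuous_partials hu h d).locallyIntegrable, fun _ hφ hφc =>
      integral_mul_iteratedFDeriv hu huc hφ hφc _⟩⟩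

theorem decayFrom_partials {n : ℕ} {u : Euc n → ℝ} (huc : HasCompactSupport u) (k m : ℕ) :
    DecayFrom n k m (partials n u) := by
  intro h _ _ t ht
  refine (measure_mono fun x hx => ?_).trans_lt
    (huc.iteratedFDeriv (𝕜 := ℝ) h).isCompact.measure_lt_top
  by_contra hx'
  have h0 : iteratedFDeriv ℝ h u x = 0 := image_eq_zero_of_notMem_tsupport hx'
  have : t < gradLen n (partials n u) h x := hx
  simp only [gradLen, partials, h0, zero_apply, ne_eq,
    OfNat.ofNat_ne_zero, not_false_eq_true, zero_pow, Finset.sum_const_zero,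
    Real.sqrt_zero] at this
  linarith

theorem sqrt_sum_partials_sub_sq_le {n m : ℕ} (u : Euc n → ℝ) {l : ℝ} (hl : 0 < l) (x y : Euc n) :
    Real.sqrt (∑ d, (partials n u m x d / l - partials n u m y d / l) ^ 2) ≤
      Real.sqrt (Fintype.card (Fin m → Fin n)) / l *
        ‖iteratedFDeriv ℝ m u x - iteratedFDeriv ℝ m u y‖ := by
  set T := iteratedFDeriv ℝ m u x - iteratedFDeriv ℝ m u y with hT
  have h1 : ∀ d, (partials n u m x d / l - partials n u m y d / l) ^ 2 ≤ (‖T‖ / l) ^ 2 := by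
    intro d
    have h2 : partials n u m x d / l - partials n u m y d / l =
        T (fun i => EuclideanSpace.single (d (Fin.rev i)) (1 : ℝ)) / l := by
      rw [hT, ← sub_div]; rfl
    have h3 := T.le_opNorm fun i => EuclideanSpace.single (d (Fin.rev i)) (1 : ℝ)
    simp only [PiLp.norm_single, norm_one, Finset.prod_const_one, mul_one] at h3
    rw [h2, div_pow, div_pow, ← sq_abs]
    gcongr
    exact h3
  refine (Real.sqrt_le_sqrt (Finset.sum_le_sum fun d _ => h1 d)).trans (le_of_eq ?_)
  rw [Finset.sum_const, Finset.card_univ, nsmul_eq_mul, Real.sqrt_mul (by positivity),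
    Real.sqrt_sq (by positivity)]
  ring

/-- Superposition of dyadic dilations of `w`, with amplitudes `b`. -/
noncomputable def dyadicSum {n : ℕ} (s : ℝ) (w : Euc n → ℝ) (N : ℕ) (b : ℕ → ℝ) (x : Euc n) : ℝ :=
  ∑ j ∈ Finset.range N, (((2 : ℝ) ^ j) ^ s * b j) • w (((2 : ℝ) ^ j)⁻¹ • x)

theorem contDiff_dyadicSum {n : ℕ} {w : Euc n → ℝ} (hw : ContDiff ℝ (⊤ : ℕ∞) w) (s : ℝ) (N : ℕ)
    (b : ℕ → ℝ) : ContDiff ℝ (⊤ : ℕ∞) (dyadicSum s w N b) :=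
  ContDiff.sum fun _ _ => contDiff_const.fun_smul (hw.comp (contDiff_const.fun_smul contDiff_id))

theorem hasCompactSupport_dyadicSum {n : ℕ} {w : Euc n → ℝ} (hw : HasCompactSupport w) (s : ℝ)
    (N : ℕ) (b : ℕ → ℝ) : HasCompactSupport (dyadicSum s w N b) := by
  induction N with
  | zero =>
    have : dyadicSum s w 0 b = 0 := by ext; simp [dyadicSum]
    rw [this]; exact HasCompactSupport.zero
  | succ N ih =>
    have : dyadicSum s w (N + 1) b = dyadicSum s w N b +
        fun x => (((2 : ℝ) ^ N) ^ s * b N) • w (((2 : ℝ) ^ N)⁻¹ • x) := by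
      ext; simp [dyadicSum, Finset.sum_range_succ]
    rw [this]
    exact ih.add ((hw.comp_smul (by positivity)).smul_left (f := fun _ => ((2 : ℝ) ^ N) ^ s * b N))

theorem iteratedFDeriv_dyadicSum {n : ℕ} {w : Euc n → ℝ} (hw : ContDiff ℝ (⊤ : ℕ∞) w) (s : ℝ)
    (N : ℕ) (b : ℕ → ℝ) (m : ℕ) (x : Euc n) :
    iteratedFDeriv ℝ m (dyadicSum s w N b) x = ∑ j ∈ Finset.range N,
      (((2 : ℝ) ^ j) ^ (s - m) * b j) • iteratedFDeriv ℝ m w (((2 : ℝ) ^ j)⁻¹ • x) := by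
  have hwm : ContDiff ℝ m w := hw.of_le (by exact_mod_cast le_top)
  have hc : ∀ j : ℕ, ContDiff ℝ m fun x => w (((2 : ℝ) ^ j)⁻¹ • x) := fun j =>
    hwm.comp (contDiff_const.fun_smul contDiff_id)
  unfold dyadicSum
  rw [iteratedFDeriv_fun_sum_apply fun j _ => (contDiff_const.fun_smul (hc j)).contDiffAt]
  refine Finset.sum_congr rfl fun j _ => ?_
  rw [iteratedFDeriv_const_smul_apply' (hc j).contDiffAt, iteratedFDeriv_comp_const_smul _ hwm,
    smul_smul, Real.rpow_sub (by positivity), Real.rpow_natCast]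
  congr 1
  rw [inv_pow]
  ring

theorem exists_fracSem_dyadicSum_le {n : ℕ} (hn : 0 < n) {s : ℝ} {m : ℕ} (h0 : 0 < s - m)
    (h1 : s - m < 1) {A : ℝ → ℝ≥0∞} (hA : IsYoung A) {w : Euc n → ℝ}
    (hw : ContDiff ℝ (⊤ : ℕ∞) w) (hwc : HasCompactSupport w) :
    ∃ l : ℝ, 0 < l ∧ ∀ (N : ℕ) (b : ℕ → ℝ), (∀ j, 0 ≤ b j) →
      ∑ j ∈ Finset.range N, ENNReal.ofReal (((2 : ℝ) ^ j) ^ n) * A (b j) ≤ 1 →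
      fracSem n (s - m) A (partials n (dyadicSum s w N b) m) ≤ ENNReal.ofReal l := by
  obtain ⟨M, R, hM, hG⟩ := exists_norm_sub_le_indicator (G := iteratedFDeriv ℝ m w)
    ((hw.iteratedFDeriv_right (m := (⊤ : ℕ∞)) (by exact_mod_cast le_top)).of_le (by simp))
    (hwc.iteratedFDeriv m)
  obtain ⟨C, hC0, hC⟩ := exists_sum_truncProfile_le h0 h1
  set I := ∫⁻ x : Euc n, ∫⁻ y : Euc n, pairKernel n (s - m) R x y with hI
  have hIt : I ≠ ⊤ := (lintegral_pairKernel_lt_top hn h0 h1 R).ne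
  set K := Real.sqrt (Fintype.card (Fin m → Fin n)) with hK
  have hK0 : 0 ≤ K := Real.sqrt_nonneg _
  have hI0 : 0 ≤ I.toReal := ENNReal.toReal_nonneg
  set l := K * M * (2 * C) + K * M * I.toReal + 1 with hl
  have hl0 : 0 < l := by positivity
  refine ⟨l, hl0, fun N b hb hbA => sInf_le ⟨l, ⟨hl0, ?_⟩, rfl⟩⟩
  refine (Jfun_le_of_pairProfile hA (L := K * M / l) (R := R) _ (by positivity) ?_ hC ?_ N hb
    fun x y => ?_).trans hbA
  · rw [div_mul_eq_mul_div, div_le_one hl0, hl]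
    have : 0 ≤ K * M * I.toReal := by positivity
    linarith
  · rw [← hI, ← ENNReal.ofReal_toReal hIt, ← ENNReal.ofReal_mul (by positivity),
      ENNReal.ofReal_le_one, div_mul_eq_mul_div, div_le_one hl0, hl]
    have : 0 ≤ K * M * (2 * C) := by positivity
    linarith
  · rcases eq_or_ne x y with rfl | hxy
    · simp only [sub_self, ne_eq, OfNat.ofNat_ne_zero, not_false_eq_true, zero_pow,
        Finset.sum_const_zero, Real.sqrt_zero, zero_div]
      exact Finset.sum_nonneg fun j _ =>
        mul_nonneg (mul_nonneg (by positivity) (pairProfile_nonneg _ _ _ _)) (hb j)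
    have hpos : 0 < ‖x - y‖ := norm_pos_iff.2 (sub_ne_zero.2 hxy)
    rw [div_le_iff₀ (by positivity)]
    refine (sqrt_sum_partials_sub_sq_le _ hl0 x y).trans ?_
    rw [iteratedFDeriv_dyadicSum hw, iteratedFDeriv_dyadicSum hw, ← Finset.sum_sub_distrib,
      Finset.sum_mul]
    refine (mul_le_mul_of_nonneg_left (norm_sum_le _ _) (by positivity)).trans ?_
    rw [Finset.mul_sum]
    refine Finset.sum_le_sum fun j _ => ?_
    set c := ((2 : ℝ) ^ j)⁻¹ with hc
    have hc0 : 0 < c := by positivity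
    have hnorm : ‖c • x - c • y‖ = c * ‖x - y‖ := by
      rw [← smul_sub, norm_smul, Real.norm_of_nonneg hc0.le]
    have hcs : c ^ (-(s - m)) = ((2 : ℝ) ^ j) ^ (s - m) := by
      rw [hc, Real.inv_rpow (by positivity), Real.rpow_neg (by positivity), inv_inv]
    rw [← smul_sub, norm_smul, Real.norm_of_nonneg (mul_nonneg (by positivity) (hb j))]
    refine (mul_le_mul_of_nonneg_left (mul_le_mul_of_nonneg_left (hG (c • x) (c • y))
      (mul_nonneg (by positivity) (hb j))) (by positivity)).trans (le_of_eq ?_)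
    rw [pairProfile, truncProfile, hnorm, Real.mul_rpow hc0.le hpos.le, hcs,
      Real.rpow_neg hpos.le]
    field_simp
    ring

theorem exists_bump_eq_pow {n : ℕ} (i₀ : Fin n) (k : ℕ) :
    ∃ w : Euc n → ℝ, ContDiff ℝ (⊤ : ℕ∞) w ∧ HasCompactSupport w ∧
      ∀ x ∈ ball (0 : Euc n) (k + 3), w x = (x i₀) ^ (k + 1) := by
  let f : ContDiffBump (0 : Euc n) := ⟨k + 3, k + 4, by positivity, by linarith⟩
  refine ⟨fun x => (x i₀) ^ (k + 1) * f x, ?_, f.hasCompactSupport.mul_left, fun x hx => ?_⟩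
  · exact ((by fun_prop : ContDiff ℝ (⊤ : ℕ∞) fun x : Euc n => (x i₀) ^ (k + 1))).mul f.contDiff
  · simp only
    rw [f.one_of_mem_closedBall (ball_subset_closedBall hx), mul_one]

theorem dyadicSum_eq_of_mem_ball {n k : ℕ} {i₀ : Fin n} {w : Euc n → ℝ}
    (hw : ∀ x ∈ ball (0 : Euc n) (k + 3), w x = (x i₀) ^ (k + 1)) (s : ℝ) (N : ℕ) (b : ℕ → ℝ)
    {x : Euc n} (hx : x ∈ ball (0 : Euc n) (k + 3)) :
    dyadicSum s w N b x =
      (∑ j ∈ Finset.range N, ((2 : ℝ) ^ j) ^ (s - k - 1) * b j) * (x i₀) ^ (k + 1) := by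
  rw [dyadicSum, Finset.sum_mul]
  refine Finset.sum_congr rfl fun j _ => ?_
  rw [hw, sub_sub, Real.rpow_sub (by positivity), ← Nat.cast_succ, Real.rpow_natCast]
  · simp only [PiLp.smul_apply, smul_eq_mul, mul_pow, inv_pow, Nat.succ_eq_add_one]
    ring
  · rw [mem_ball_zero_iff] at hx ⊢
    rw [norm_smul, Real.norm_of_nonneg (by positivity)]
    have : ((2 : ℝ) ^ j)⁻¹ ≤ 1 := inv_le_one_of_one_le₀ (one_le_pow₀ one_le_two)
    nlinarith [norm_nonneg x]

/-- An embedding into a Campanato space forces the dyadic bound. -/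
theorem exists_dyadicBound {n : ℕ} (hn : 0 < n) {s : ℝ} (h0 : 0 < s - ⌊s⌋₊) (h1 : s - ⌊s⌋₊ < 1)
    {A : ℝ → ℝ≥0∞} (hA : IsYoung A) (k : ℕ) {φ : ℝ → ℝ} (hφ : Admissible φ) {c : ℝ} (hc : 0 < c)
    (h : ∀ (u : Euc n → ℝ) (D : (h : ℕ) → Euc n → (Fin h → Fin n) → ℝ),
        HasWeakDerivs n ⌊s⌋₊ u D → DecayFrom n (k + 1) ⌊s⌋₊ D →
        fracSem n (s - (⌊s⌋₊ : ℝ)) A (D ⌊s⌋₊) < ⊤ →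
        campSemK n k φ u D ≤ ENNReal.ofReal c * fracSem n (s - (⌊s⌋₊ : ℝ)) A (D ⌊s⌋₊)) :
    ∃ M, DyadicBound n (s - k - 1) A M := by
  set i₀ : Fin n := ⟨0, hn⟩
  obtain ⟨w, hw, hwc, hwe⟩ := exists_bump_eq_pow i₀ k
  obtain ⟨l, hl, hsem⟩ := exists_fracSem_dyadicSum_le hn h0 h1 hA hw hwc
  obtain ⟨κ, hκ, hosc⟩ := exists_mul_le_oscQuotK i₀ k hφ
  refine ⟨c * l / κ, fun N b hb hbA => ?_⟩
  set u := dyadicSum s w N b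
  have hu := contDiff_dyadicSum hw s N b
  have huc := hasCompactSupport_dyadicSum hwc s N b
  have hS := hsem N b hb hbA
  have h2 := h u (partials n u) (hasWeakDerivs_partials hu huc _) (decayFrom_partials huc _ _)
    (hS.trans_lt ENNReal.ofReal_lt_top)
  have h3 : oscQuotK n k φ u (partials n u) 0 (k + 3) ≤ campSemK n k φ u (partials n u) :=
    le_iSup_of_le 0 (le_iSup₂_of_le ((k : ℝ) + 3) (by positivity) le_rfl)
  have h4 := (hosc u (partials n u) _ fun x hx => dyadicSum_eq_of_mem_ball hwe s N b hx).trans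
    (h3.trans (h2.trans (mul_le_mul_right hS _)))
  rw [← ENNReal.ofReal_mul hc.le, ENNReal.ofReal_le_ofReal_iff (by positivity)] at h4
  rw [le_div_iff₀' hκ]
  exact (mul_le_mul_of_nonneg_left (le_abs_self _) hκ.le).trans h4

/-- Admissible parameters for general `k ∈ {0,…,[s]-1}`: if
`V^{s,A}_{d,k+1}(ℝⁿ)` embeds into some `k`-th order Campanato space `𝓛^{k,φ}(ℝⁿ)` with
`φ` admissible, then `s < n + k + 1` and
`∫_0 (t/A(t))^{(s-(k+1))/(n-(s-(k+1)))} dt < ∞`. -/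
theorem stmt11 (n : ℕ) (hn : 0 < n) (s : ℝ) (hs1 : 1 < s) (hs2 : ∀ m : ℕ, s ≠ (m : ℝ))
    (A : ℝ → ℝ≥0∞) (hA : IsYoung A) (k : ℕ) (hk : k < ⌊s⌋₊)
    (h : ∃ (φ : ℝ → ℝ) (c : ℝ), Admissible φ ∧ 0 < c ∧
      ∀ (u : Euc n → ℝ) (D : (h : ℕ) → Euc n → (Fin h → Fin n) → ℝ),
        HasWeakDerivs n ⌊s⌋₊ u D → DecayFrom n (k + 1) ⌊s⌋₊ D →
        fracSem n (s - (⌊s⌋₊ : ℝ)) A (D ⌊s⌋₊) < ⊤ →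
        campSemK n k φ u D ≤ ENNReal.ofReal c * fracSem n (s - (⌊s⌋₊ : ℝ)) A (D ⌊s⌋₊)) :
    s < (n : ℝ) + (k : ℝ) + 1 ∧ IntCondK n s k A := by
  obtain ⟨φ, c, hφ, hc, h⟩ := h
  have hfl : (⌊s⌋₊ : ℝ) < s :=
    lt_of_le_of_ne (Nat.floor_le (by linarith)) (hs2 _).symm
  have hfl1 := Nat.lt_floor_add_one s
  have hkf : (k : ℝ) + 1 ≤ ⌊s⌋₊ := by exact_mod_cast hk
  obtain ⟨M, hM⟩ := exists_dyadicBound hn (by linarith) (by linarith) hA k hφ hc h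
  have hne : s - k - 1 ≠ n := fun he => hs2 (n + k + 1) (by push_cast; linarith)
  have hlt := hM.lt_dim hA hne
  exact ⟨by linarith, 1, one_pos, hM.lintegral_lt_top hA (by linarith) hlt⟩
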